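/- (Proposition 4: optimality gap of the approximation algorithm.) Assume f_s ≥ 0 and c_s ≥ 0 componentwise for every stage s, λ_s ∈ [0,1] and α_s ∈ [0,1) for s = 2,…,T, p as specified, and every B_s with nonnegative entries. Let (x⁰, y⁰, η⁰, u⁰) be an optimal solution of the LP relaxation of the multistage model (i.e. feasible for it with objective value ≤ that of every tuple feasible for it), and let (x¹, η¹) be an optimal solution of SP-RMS(y⁰, u⁰). Then (x¹, y⁰, η¹, u⁰) is multistage-feasible and F(x¹, y⁰, η¹, u⁰) − z^MS ≤ ∑_{s=1}^T ∑_{i=1}^M f_{s,i}, where z^MS is the infimum of F over multistage-feasible tuples (a real number, since this set is nonempty and F ≥ 0 on it under the stated assumptions). -/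

import Mathlib

open Finset

/-- A scenario tree with `T` stages: a finite nonempty set of nodes with a root,
a parent map fixing the root, a stage map decreasing by one along the parent map,
such that every node reaches the root by iterating the parent map, and every
non-leaf node has a child. -/
structure STree (T : ℕ) : Type 1 where
  Node : Type
  fin : Fintype Node
  deceq : DecidableEq Node
  root : Node
  parent : Node → Node
  stage : Node → ℕ
  hT : 1 ≤ T
  parent_root : parent root = root
  stage_root : stage root = 1
  stage_ge : ∀ n, 1 ≤ stage n
  stage_le : ∀ n, stage n ≤ T
  stage_parent : ∀ n, n ≠ root → stage (parent n) = stage n - 1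
  reaches_root : ∀ n, ∃ k, parent^[k] n = root
  children_ne : ∀ n, stage n ≠ T → ∃ m, m ≠ root ∧ parent m = n

attribute [instance] STree.fin STree.deceq

namespace STree

variable {T : ℕ} (S : STree T)

/-- The path set `𝒫(n) = {aᵏ(n) : k ≥ 0}` of a node. -/
def path (n : S.Node) : Finset S.Node :=
  (Finset.range T).image fun k => S.parent^[k] n

theorem path_nonempty (n : S.Node) : (S.path n).Nonempty :=
  ⟨n, Finset.mem_image.mpr ⟨0, Finset.mem_range.mpr S.hT, rfl⟩⟩

/-- The children `𝒞(n)` of a node. -/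
def children (n : S.Node) : Finset S.Node :=
  Finset.univ.filter fun m => m ≠ S.root ∧ S.parent m = n

theorem children_nonempty {n : S.Node} (h : S.stage n ≠ T) : (S.children n).Nonempty := by
  obtain ⟨m, h1, h2⟩ := S.children_ne n h
  exact ⟨m, Finset.mem_filter.mpr ⟨Finset.mem_univ m, h1, h2⟩⟩

/-- The set `𝒯ₛ` of stage-`s` nodes. -/
def stageNodes (s : ℕ) : Finset S.Node :=
  Finset.univ.filter fun n => S.stage n = s

theorem stageNodes_self_nonempty (n : S.Node) : (S.stageNodes (S.stage n)).Nonempty :=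
  ⟨n, Finset.mem_filter.mpr ⟨Finset.mem_univ n, rfl⟩⟩

end STree

section Constructions

variable {T M J : ℕ}

/-- `b_n = B_{τ(n)} ŷ_n` (componentwise). -/
noncomputable def bvec (S : STree T) (B : ℕ → Matrix (Fin M) (Fin J) ℝ)
    (yh : S.Node → Fin J → ℝ) (n : S.Node) (i : Fin M) : ℝ :=
  (B (S.stage n)).mulVec (yh n) i

/-- Componentwise maximum of `b` over all nodes of the same stage as `n`
(used for `b̄_n = max_{l ∈ 𝒯_{τ(n)}} b_l`). -/
noncomputable def stageMax (S : STree T) (b : S.Node → Fin M → ℝ) (n : S.Node) (i : Fin M) : ℝ :=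
  (S.stageNodes (S.stage n)).sup' (S.stageNodes_self_nonempty n) fun l => b l i

/-- `max_{m ∈ 𝒫(n)} ⌈b_m⌉` (componentwise). -/
noncomputable def pmc (S : STree T) (b : S.Node → Fin M → ℝ) (n : S.Node) (i : Fin M) : ℤ :=
  (S.path n).sup' (S.path_nonempty n) fun m => ⌈b m i⌉

/-- `max_{m ∈ 𝒫(n)} b_m` (componentwise, no rounding). -/
noncomputable def pm (S : STree T) (b : S.Node → Fin M → ℝ) (n : S.Node) (i : Fin M) : ℝ :=
  (S.path n).sup' (S.path_nonempty n) fun m => b m i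

end Constructions

section CapacityModel

variable {T M N J : ℕ}

/-- Multistage feasibility (with the capacity variables `x` taken real, for LP
relaxations; the integer model uses the coercion of an integer `x`). -/
def MFeasR (S : STree T) (f : ℕ → Fin M → ℝ) (c : ℕ → Fin J → ℝ)
    (A : ℕ → Matrix (Fin N) (Fin J) ℝ) (B : ℕ → Matrix (Fin M) (Fin J) ℝ)
    (d : S.Node → Fin N → ℝ)
    (x : S.Node → Fin M → ℝ) (y : S.Node → Fin J → ℝ) (η u : S.Node → ℝ) : Prop :=
  (∀ n i, 0 ≤ x n i) ∧ (∀ n j, 0 ≤ y n j) ∧ (∀ n, n ≠ S.root → 0 ≤ u n) ∧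
  (∀ n, (A (S.stage n)).mulVec (y n) = d n) ∧
  (∀ n i, (B (S.stage n)).mulVec (y n) i ≤ ∑ m ∈ S.path n, x m i) ∧
  ∀ n, n ≠ S.root →
    (∑ i, f (S.stage n) i * ∑ m ∈ S.path n, x m i) + (∑ j, c (S.stage n) j * y n j)
      ≤ u n + η (S.parent n)

/-- The two-stage (non-anticipativity) constraint: capacity decisions agree on
nodes of the same stage. -/
def TSconstr (S : STree T) (x : S.Node → Fin M → ℝ) : Prop :=
  ∀ m n, S.stage m = S.stage n → x m = x n

/-- The risk-averse objective
`F(x,y,η,u) = ∑_n p_n ( f̃_n·∑_{m∈𝒫(n)} x_m + c̃_n·y_n + λ̃_n η_n + α̃_n u_n )`,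
where `f̃, c̃, λ̃, α̃` are the derived ECRM coefficients. -/
noncomputable def FR (S : STree T) (p : S.Node → ℝ) (f : ℕ → Fin M → ℝ) (c : ℕ → Fin J → ℝ)
    (lam alpha : ℕ → ℝ)
    (x : S.Node → Fin M → ℝ) (y : S.Node → Fin J → ℝ) (η u : S.Node → ℝ) : ℝ :=
  ∑ n, p n *
    ((∑ i, (if n = S.root then f 1 i else (1 - lam (S.stage n)) * f (S.stage n) i)
        * ∑ m ∈ S.path n, x m i)
     + (∑ j, (if n = S.root then c 1 j else (1 - lam (S.stage n)) * c (S.stage n) j) * y n j)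
     + (if S.stage n = T then 0 else lam (S.stage n + 1)) * η n
     + (if n = S.root then 0 else lam (S.stage n) / (1 - alpha (S.stage n))) * u n)

/-- Optimal value of the risk-averse multistage model (integer capacities). -/
noncomputable def zMS (S : STree T) (p : S.Node → ℝ) (f : ℕ → Fin M → ℝ) (c : ℕ → Fin J → ℝ)
    (A : ℕ → Matrix (Fin N) (Fin J) ℝ) (B : ℕ → Matrix (Fin M) (Fin J) ℝ)
    (d : S.Node → Fin N → ℝ) (lam alpha : ℕ → ℝ) : ℝ :=
  sInf {v : ℝ | ∃ (x : S.Node → Fin M → ℤ) (y : S.Node → Fin J → ℝ) (η u : S.Node → ℝ),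
    MFeasR S f c A B d (fun n i => (x n i : ℝ)) y η u ∧
    v = FR S p f c lam alpha (fun n i => (x n i : ℝ)) y η u}

/-- Optimal value of the risk-averse two-stage model (integer capacities). -/
noncomputable def zTS (S : STree T) (p : S.Node → ℝ) (f : ℕ → Fin M → ℝ) (c : ℕ → Fin J → ℝ)
    (A : ℕ → Matrix (Fin N) (Fin J) ℝ) (B : ℕ → Matrix (Fin M) (Fin J) ℝ)
    (d : S.Node → Fin N → ℝ) (lam alpha : ℕ → ℝ) : ℝ :=
  sInf {v : ℝ | ∃ (x : S.Node → Fin M → ℤ) (y : S.Node → Fin J → ℝ) (η u : S.Node → ℝ),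
    MFeasR S f c A B d (fun n i => (x n i : ℝ)) y η u ∧
    TSconstr S (fun n i => (x n i : ℝ)) ∧
    v = FR S p f c lam alpha (fun n i => (x n i : ℝ)) y η u}

end CapacityModel

section Substructure

variable {T M J : ℕ}

/-- Feasibility for the substructure problem SP-RMS(ŷ,û). -/
def FeasSP (S : STree T) (f : ℕ → Fin M → ℝ) (c : ℕ → Fin J → ℝ)
    (B : ℕ → Matrix (Fin M) (Fin J) ℝ)
    (yh : S.Node → Fin J → ℝ) (uh : S.Node → ℝ)
    (x : S.Node → Fin M → ℤ) (η : S.Node → ℝ) : Prop :=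
  (∀ n i, 0 ≤ x n i) ∧
  (∀ n i, (B (S.stage n)).mulVec (yh n) i ≤ ∑ m ∈ S.path n, (x m i : ℝ)) ∧
  ∀ n, n ≠ S.root →
    (∑ i, f (S.stage n) i * ∑ m ∈ S.path n, (x m i : ℝ))
      + (∑ j, c (S.stage n) j * yh n j) - uh n ≤ η (S.parent n)

/-- Objective `G(x,η) = ∑_n p_n ( f̃_n · ∑_{m∈𝒫(n)} x_m + λ̃_n η_n )` of the
substructure problem, where `f̃` and `λ̃` are the derived coefficients. -/
noncomputable def Gobj (S : STree T) (p : S.Node → ℝ) (f : ℕ → Fin M → ℝ) (lam : ℕ → ℝ)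
    (x : S.Node → Fin M → ℤ) (η : S.Node → ℝ) : ℝ :=
  ∑ n, p n *
    ((∑ i, (if n = S.root then f 1 i else (1 - lam (S.stage n)) * f (S.stage n) i)
        * ∑ m ∈ S.path n, (x m i : ℝ))
     + (if S.stage n = T then 0 else lam (S.stage n + 1)) * η n)

end Substructure

namespace STree

variable {T : ℕ} (S : STree T)

theorem two_le_stage {n : S.Node} (hn : n ≠ S.root) : 2 ≤ S.stage n := by
  have h1 := S.stage_parent n hn
  have h2 := S.stage_ge (S.parent n)
  omega

theorem stage_eq_one_iff (n : S.Node) : S.stage n = 1 ↔ n = S.root := by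
  constructor
  · intro h
    by_contra hn
    have := S.two_le_stage hn
    omega
  · rintro rfl
    exact S.stage_root

theorem iterate_parent_root (k : ℕ) : S.parent^[k] S.root = S.root :=
  Function.iterate_fixed S.parent_root k

theorem iterate_parent_eq_root (k : ℕ) (n : S.Node) (h : S.stage n ≤ k + 1) :
    S.parent^[k] n = S.root := by
  induction k generalizing n with
  | zero =>
    have := S.stage_ge n
    exact (S.stage_eq_one_iff n).1 (by omega)
  | succ k ih =>
    by_cases hn : n = S.root
    · rw [hn, S.iterate_parent_root]
    · rw [Function.iterate_succ_apply]
      have := S.stage_parent n hn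
      exact ih _ (by omega)

theorem stage_iterate_parent_le (k : ℕ) (n : S.Node) : S.stage (S.parent^[k] n) ≤ S.stage n := by
  induction k with
  | zero => exact le_rfl
  | succ k ih =>
    rw [Function.iterate_succ_apply']
    refine le_trans ?_ ih
    by_cases h : S.parent^[k] n = S.root
    · rw [h, S.parent_root]
    · have := S.stage_parent _ h
      omega

theorem path_root : S.path S.root = {S.root} := by
  ext m
  simp only [path, S.iterate_parent_root, Finset.mem_image, Finset.mem_range,
    Finset.mem_singleton]
  exact ⟨fun ⟨_, _, h⟩ => h.symm, fun h => ⟨0, S.hT, h.symm⟩⟩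

theorem path_eq_insert {n : S.Node} (hn : n ≠ S.root) :
    S.path n = insert n (S.path (S.parent n)) := by
  have hT := S.hT
  have hroot : ∀ m k, T ≤ k + 1 → S.parent^[k] m = S.root := fun m k hk =>
    S.iterate_parent_eq_root k m ((S.stage_le m).trans hk)
  ext m
  simp only [path, Finset.mem_insert, Finset.mem_image, Finset.mem_range,
    ← Function.iterate_succ_apply]
  constructor
  · rintro ⟨k, hk, rfl⟩
    cases k with
    | zero => exact Or.inl rfl
    | succ k => exact Or.inr ⟨k, by omega, rfl⟩
  · rintro (rfl | ⟨k, hk, rfl⟩)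
    · exact ⟨0, hT, rfl⟩
    · by_cases h : k + 1 < T
      · exact ⟨k + 1, h, rfl⟩
      · exact ⟨T - 1, by omega, by rw [hroot _ _ (by omega), hroot _ _ (by omega)]⟩

theorem notMem_path_parent {n : S.Node} (hn : n ≠ S.root) : n ∉ S.path (S.parent n) := by
  simp only [path, Finset.mem_image, Finset.mem_range, not_exists, not_and]
  intro k _ h
  have h1 := S.stage_iterate_parent_le k (S.parent n)
  rw [h, S.stage_parent n hn] at h1
  have := S.stage_ge n
  omega

theorem sum_path {α : Type*} [AddCommMonoid α] (g : S.Node → α) {n : S.Node} (hn : n ≠ S.root) :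
    ∑ m ∈ S.path n, g m = g n + ∑ m ∈ S.path (S.parent n), g m := by
  rw [S.path_eq_insert hn, Finset.sum_insert (S.notMem_path_parent hn)]

/-- Increments of a function on nodes along the tree, so that path sums recover the function. -/
def increment {α : Type*} [AddGroup α] (X : S.Node → α) (n : S.Node) : α :=
  if n = S.root then X n else X n - X (S.parent n)

theorem sum_path_increment {α : Type*} [AddCommGroup α] (X : S.Node → α) (n : S.Node) :
    ∑ m ∈ S.path n, S.increment X m = X n := by
  induction h : S.stage n using Nat.strong_induction_on generalizing n with
  | _ s ih =>
    by_cases hn : n = S.root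
    · rw [hn, S.path_root, Finset.sum_singleton, increment, if_pos rfl]
    · have h1 := S.stage_parent n hn
      have h2 := S.two_le_stage hn
      rw [S.sum_path _ hn, ih _ (by omega) (S.parent n) rfl, increment, if_neg hn,
        sub_add_cancel]

/-- The expectation of a stage-dependent quantity is its sum over stages. -/
theorem sum_prob_mul_stage (p : S.Node → ℝ)
    (hp1 : ∀ s, 1 ≤ s → s ≤ T → ∑ n ∈ S.stageNodes s, p n = 1) (g : ℕ → ℝ) :
    ∑ n, p n * g (S.stage n) = ∑ s ∈ Finset.Icc 1 T, g s := by
  rw [← Finset.sum_fiberwise_of_maps_to (s := Finset.univ) (t := Finset.Icc 1 T) (g := S.stage)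
    (fun n _ => Finset.mem_Icc.2 ⟨S.stage_ge n, S.stage_le n⟩)]
  refine Finset.sum_congr rfl fun s hs => ?_
  rw [Finset.mem_Icc] at hs
  calc ∑ n ∈ Finset.univ with S.stage n = s, p n * g (S.stage n)
      = ∑ n ∈ S.stageNodes s, p n * g s := by
        refine Finset.sum_congr rfl fun n hn => ?_
        rw [(Finset.mem_filter.1 hn).2]
    _ = g s := by rw [← Finset.sum_mul, hp1 s hs.1 hs.2, one_mul]

/-- The derived weights `1 - λ` at a stage and `λ` at the preceding stage add up to one. -/
theorem sum_prob_mul_derived (p : S.Node → ℝ)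
    (hp1 : ∀ s, 1 ≤ s → s ≤ T → ∑ n ∈ S.stageNodes s, p n = 1) (lam φ : ℕ → ℝ) :
    ∑ n, p n * ((if n = S.root then φ 1 else (1 - lam (S.stage n)) * φ (S.stage n))
      + (if S.stage n = T then 0 else lam (S.stage n + 1)) * φ (S.stage n + 1))
      = ∑ s ∈ Finset.Icc 1 T, φ s := by
  have hT := S.hT
  let h : ℕ → ℝ := fun s => if s ≤ 1 ∨ T < s then 0 else lam s * φ s
  have key : ∀ n, (if n = S.root then φ 1 else (1 - lam (S.stage n)) * φ (S.stage n))
      + (if S.stage n = T then 0 else lam (S.stage n + 1)) * φ (S.stage n + 1)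
      = φ (S.stage n) + (h (S.stage n + 1) - h (S.stage n)) := by
    intro n
    have h1 := S.stage_ge n
    have h2 := S.stage_le n
    have e1 : (if n = S.root then φ 1 else (1 - lam (S.stage n)) * φ (S.stage n))
        = φ (S.stage n) - h (S.stage n) := by
      by_cases hn : n = S.root
      · simp [h, hn, S.stage_root]
      · have := S.two_le_stage hn
        have h3 : ¬ (S.stage n ≤ 1 ∨ T < S.stage n) := by omega
        simp only [h, if_neg hn, if_neg h3]
        ring
    have e2 : (if S.stage n = T then 0 else lam (S.stage n + 1)) * φ (S.stage n + 1)
        = h (S.stage n + 1) := by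
      by_cases hn : S.stage n = T
      · simp [h, hn]
      · have h3 : ¬ (S.stage n + 1 ≤ 1 ∨ T < S.stage n + 1) := by omega
        simp only [h, if_neg hn, if_neg h3]
    rw [e1, e2]
    ring
  have htel : ∑ s ∈ Finset.Icc 1 T, (h (s + 1) - h s) = 0 := by
    rw [← Finset.Ico_add_one_right_eq_Icc, Finset.sum_Ico_sub h (by omega)]
    simp [h]
  simp_rw [key]
  rw [S.sum_prob_mul_stage p hp1 fun s => φ s + (h (s + 1) - h s), Finset.sum_add_distrib, htel,
    add_zero]

end STree

section Rounding

variable {T M N J : ℕ}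

/-- Capacities whose cumulative values are the ceilings of the cumulative values of `x`. -/
noncomputable def roundUp (S : STree T) (x : S.Node → Fin M → ℝ) (n : S.Node) (i : Fin M) : ℤ :=
  S.increment (fun n => ⌈∑ m ∈ S.path n, x m i⌉) n

theorem sum_path_roundUp (S : STree T) (x : S.Node → Fin M → ℝ) (n : S.Node) (i : Fin M) :
    ∑ m ∈ S.path n, (roundUp S x m i : ℝ) = (⌈∑ m ∈ S.path n, x m i⌉ : ℤ) := by
  rw [← Int.cast_sum]
  exact congrArg _ (S.sum_path_increment (fun n => ⌈∑ m ∈ S.path n, x m i⌉) n)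

theorem sum_path_roundUp_le (S : STree T) (x : S.Node → Fin M → ℝ) (n : S.Node) (i : Fin M) :
    ∑ m ∈ S.path n, (roundUp S x m i : ℝ) ≤ ∑ m ∈ S.path n, x m i + 1 := by
  rw [sum_path_roundUp]
  exact (Int.ceil_lt_add_one _).le

theorem roundUp_nonneg (S : STree T) {x : S.Node → Fin M → ℝ} (hx : ∀ n i, 0 ≤ x n i)
    (n : S.Node) (i : Fin M) : 0 ≤ roundUp S x n i := by
  unfold roundUp STree.increment
  split_ifs with hn
  · exact Int.ceil_nonneg (Finset.sum_nonneg fun m _ => hx m i)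
  · rw [sub_nonneg]
    beta_reduce
    rw [S.sum_path _ hn]
    exact Int.ceil_mono (le_add_of_nonneg_left (hx n i))

/-- The rounded capacities, with `η` raised by the maintenance cost of the next stage,
are feasible for the substructure problem. -/
theorem feasSP_roundUp (S : STree T) {f : ℕ → Fin M → ℝ} {c : ℕ → Fin J → ℝ}
    {A : ℕ → Matrix (Fin N) (Fin J) ℝ} {B : ℕ → Matrix (Fin M) (Fin J) ℝ}
    {d : S.Node → Fin N → ℝ} (hf : ∀ s, 1 ≤ s → s ≤ T → ∀ i, 0 ≤ f s i)
    {x : S.Node → Fin M → ℝ} {y : S.Node → Fin J → ℝ} {η u : S.Node → ℝ}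
    (h : MFeasR S f c A B d x y η u) :
    FeasSP S f c B y u (roundUp S x) (fun n => η n + ∑ i, f (S.stage n + 1) i) := by
  obtain ⟨hx, -, -, -, hB, hη⟩ := h
  refine ⟨roundUp_nonneg S hx, fun n i => ?_, fun n hn => ?_⟩
  · rw [sum_path_roundUp]
    exact (hB n i).trans (Int.le_ceil _)
  · have hs : S.stage (S.parent n) + 1 = S.stage n := by
      have := S.stage_parent n hn
      have := S.stage_ge n
      omega
    have hle : ∑ i, f (S.stage n) i * ∑ m ∈ S.path n, (roundUp S x m i : ℝ)
        ≤ ∑ i, f (S.stage n) i * ∑ m ∈ S.path n, x m i + ∑ i, f (S.stage n) i := by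
      rw [← Finset.sum_add_distrib]
      refine Finset.sum_le_sum fun i _ => ?_
      have := mul_le_mul_of_nonneg_left (sum_path_roundUp_le S x n i)
        (hf _ (S.stage_ge n) (S.stage_le n) i)
      rwa [mul_add, mul_one] at this
    have := hη n hn
    simp only [hs]
    linarith

theorem FR_roundUp_le (S : STree T) (p : S.Node → ℝ) (f : ℕ → Fin M → ℝ) (c : ℕ → Fin J → ℝ)
    (lam alpha : ℕ → ℝ) (hp : ∀ n, 0 ≤ p n)
    (hp1 : ∀ s, 1 ≤ s → s ≤ T → ∑ n ∈ S.stageNodes s, p n = 1)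
    (hf : ∀ s, 1 ≤ s → s ≤ T → ∀ i, 0 ≤ f s i)
    (hlam : ∀ s, 2 ≤ s → s ≤ T → lam s ≤ 1)
    (x : S.Node → Fin M → ℝ) (y : S.Node → Fin J → ℝ) (η u : S.Node → ℝ) :
    FR S p f c lam alpha (fun n i => (roundUp S x n i : ℝ)) y
        (fun n => η n + ∑ i, f (S.stage n + 1) i) u
      ≤ FR S p f c lam alpha x y η u + ∑ s ∈ Finset.Icc 1 T, ∑ i, f s i := by
  rw [← S.sum_prob_mul_derived p hp1 lam fun s => ∑ i, f s i]
  unfold FR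
  rw [← Finset.sum_add_distrib]
  refine Finset.sum_le_sum fun n _ => ?_
  rw [← mul_add]
  refine mul_le_mul_of_nonneg_left ?_ (hp n)
  have hcoef : ∀ i, 0 ≤ if n = S.root then f 1 i else (1 - lam (S.stage n)) * f (S.stage n) i := by
    intro i
    split_ifs with hn
    · exact hf 1 le_rfl S.hT i
    · exact mul_nonneg (sub_nonneg.2 (hlam _ (S.two_le_stage hn) (S.stage_le n)))
        (hf _ (S.stage_ge n) (S.stage_le n) i)
  have hsum : (if n = S.root then ∑ i, f 1 i else (1 - lam (S.stage n)) * ∑ i, f (S.stage n) i)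
      = ∑ i, if n = S.root then f 1 i else (1 - lam (S.stage n)) * f (S.stage n) i := by
    split_ifs
    · rfl
    · rw [Finset.mul_sum]
  have hle : ∑ i, (if n = S.root then f 1 i else (1 - lam (S.stage n)) * f (S.stage n) i)
        * ∑ m ∈ S.path n, (roundUp S x m i : ℝ)
      ≤ ∑ i, (if n = S.root then f 1 i else (1 - lam (S.stage n)) * f (S.stage n) i)
          * ∑ m ∈ S.path n, x m i
        + ∑ i, if n = S.root then f 1 i else (1 - lam (S.stage n)) * f (S.stage n) i := by
    rw [← Finset.sum_add_distrib]
    refine Finset.sum_le_sum fun i _ => ?_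
    have := mul_le_mul_of_nonneg_left (sum_path_roundUp_le S x n i) (hcoef i)
    rwa [mul_add, mul_one] at this
  rw [hsum, mul_add]
  linarith

/-- At integer capacities the full objective is the substructure objective plus a term
depending only on `y` and `u`. -/
theorem FR_eq_Gobj_add (S : STree T) (p : S.Node → ℝ) (f : ℕ → Fin M → ℝ) (c : ℕ → Fin J → ℝ)
    (lam alpha : ℕ → ℝ) (x : S.Node → Fin M → ℤ) (y : S.Node → Fin J → ℝ) (η u : S.Node → ℝ) :
    FR S p f c lam alpha (fun n i => (x n i : ℝ)) y η u = Gobj S p f lam x η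
      + ∑ n, p n *
        ((∑ j, (if n = S.root then c 1 j else (1 - lam (S.stage n)) * c (S.stage n) j) * y n j)
         + (if n = S.root then 0 else lam (S.stage n) / (1 - alpha (S.stage n))) * u n) := by
  unfold FR Gobj
  rw [← Finset.sum_add_distrib]
  refine Finset.sum_congr rfl fun n _ => ?_
  ring

end Rounding

/-- Proposition 4: the tuple produced by one step of the
approximation algorithm, started from an optimal solution of the LP relaxation
of the multistage model, is multistage feasible and its optimality gap is at
most the total maintenance cost `∑_{s=1}^T ∑_{i=1}^M f_{s,i}`. -/
theorem approx_optimality_gap {T M N J : ℕ} (S : STree T)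
    (p : S.Node → ℝ) (f : ℕ → Fin M → ℝ) (c : ℕ → Fin J → ℝ)
    (A : ℕ → Matrix (Fin N) (Fin J) ℝ) (B : ℕ → Matrix (Fin M) (Fin J) ℝ)
    (d : S.Node → Fin N → ℝ) (lam alpha : ℕ → ℝ)
    (hp : ∀ n, 0 ≤ p n)
    (hp1 : ∀ s, 1 ≤ s → s ≤ T → ∑ n ∈ S.stageNodes s, p n = 1)
    (hpc : ∀ n, S.stage n ≠ T → ∑ m ∈ S.children n, p m = p n)
    (hf : ∀ s, 1 ≤ s → s ≤ T → ∀ i, 0 ≤ f s i)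
    (hc : ∀ s, 1 ≤ s → s ≤ T → ∀ j, 0 ≤ c s j)
    (hlam : ∀ s, 2 ≤ s → s ≤ T → 0 ≤ lam s ∧ lam s ≤ 1)
    (halpha : ∀ s, 2 ≤ s → s ≤ T → 0 ≤ alpha s ∧ alpha s < 1)
    (hB : ∀ s, 1 ≤ s → s ≤ T → ∀ i j, 0 ≤ B s i j)
    -- (x⁰,y⁰,η⁰,u⁰): an optimal solution of the LP relaxation of the multistage model
    (x0 : S.Node → Fin M → ℝ) (y0 : S.Node → Fin J → ℝ) (eta0 u0 : S.Node → ℝ)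
    (h0feas : MFeasR S f c A B d x0 y0 eta0 u0)
    (h0opt : ∀ (x : S.Node → Fin M → ℝ) (y : S.Node → Fin J → ℝ) (η u : S.Node → ℝ),
      MFeasR S f c A B d x y η u →
      FR S p f c lam alpha x0 y0 eta0 u0 ≤ FR S p f c lam alpha x y η u)
    -- (x¹, η¹): an optimal solution of SP-RMS(y⁰, u⁰)
    (x1 : S.Node → Fin M → ℤ) (eta1 : S.Node → ℝ)
    (h1feas : FeasSP S f c B y0 u0 x1 eta1)
    (h1opt : ∀ x η, FeasSP S f c B y0 u0 x η →
      Gobj S p f lam x1 eta1 ≤ Gobj S p f lam x η) :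
    MFeasR S f c A B d (fun n i => (x1 n i : ℝ)) y0 eta1 u0 ∧
    FR S p f c lam alpha (fun n i => (x1 n i : ℝ)) y0 eta1 u0
        - zMS S p f c A B d lam alpha
      ≤ ∑ s ∈ Finset.Icc 1 T, ∑ i, f s i := by
  have hfeas : MFeasR S f c A B d (fun n i => (x1 n i : ℝ)) y0 eta1 u0 := by
    obtain ⟨hx, hxB, hxη⟩ := h1feas
    obtain ⟨-, hy, hu, hA, -, -⟩ := h0feas
    refine ⟨fun n i => Int.cast_nonneg (hx n i), hy, hu, hA, hxB, fun n hn => ?_⟩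
    have := hxη n hn
    linarith
  refine ⟨hfeas, ?_⟩
  have hG := h1opt _ _ (feasSP_roundUp S hf h0feas)
  have hF := FR_roundUp_le S p f c lam alpha hp hp1 hf (fun s h2 hT => (hlam s h2 hT).2)
    x0 y0 eta0 u0
  rw [FR_eq_Gobj_add] at hF
  have hz : FR S p f c lam alpha x0 y0 eta0 u0 ≤ zMS S p f c A B d lam alpha := by
    refine le_csInf ⟨_, x1, y0, eta1, u0, hfeas, rfl⟩ ?_
    rintro v ⟨x, y, η, u, h, rfl⟩
    exact h0opt _ y η u h
  rw [FR_eq_Gobj_add]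
  linarith
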